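/- Let ℱ be a fully Δ-capturing construction scheme whose type satisfies n_{k+1} ≥ 2^{m_k} for all k, let n ≥ 1, and let 𝔼_o = {o_α : α < ω₁} be defined as in the context. Then 𝔼_o, as a subset of the lexicographically ordered integer sequences ℤ^ω, is not (2n+2)-entangled: indeed, there is an uncountable family of pairwise disjoint (2n+2)-element subsets of 𝔼_o no two distinct members of which realize the alternating type τ(i) = 0 for even i, τ(i) = 1 for odd i, nor its flip τ¹. -/

import Mathlib

noncomputable section

open scoped Classical

/-- The first uncountable ordinal. -/
def omegaOne : Ordinal := (Cardinal.aleph 1).ord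

/-- A scheme type. -/
structure SchemeType where
  m : ℕ → ℕ
  n : ℕ → ℕ
  r : ℕ → ℕ
  m_zero : m 0 = 1
  n_ge : ∀ k, 2 ≤ n (k + 1)
  r_lt : ∀ k, r (k + 1) < m k
  m_succ : ∀ k, m (k + 1) = r (k + 1) + (m k - r (k + 1)) * n (k + 1)

/-- `A` is an initial segment of `B`. -/
def InitSeg (A B : Finset Ordinal) : Prop := ∀ a ∈ A, ∀ b ∈ B, b < a → b ∈ A

/-- `D`, `R` form the canonical decomposition of `F ∈ ℱ_{k+1}`. -/
def IsDecomposition (T : SchemeType) (ℱ : Set (Finset Ordinal)) (k : ℕ)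
    (F : Finset Ordinal) (D : ℕ → Finset Ordinal) (R : Finset Ordinal) : Prop :=
  (∀ i < T.n (k + 1), D i ∈ ℱ ∧ (D i).card = T.m k) ∧
  F = (Finset.range (T.n (k + 1))).biUnion D ∧
  R.card = T.r (k + 1) ∧
  (∀ i < T.n (k + 1), ∀ j < T.n (k + 1), i ≠ j → D i ∩ D j = R) ∧
  (∀ i < T.n (k + 1), ∀ x ∈ R, ∀ y ∈ D i \ R, x < y) ∧
  (∀ i j, i < j → j < T.n (k + 1) → ∀ x ∈ D i \ R, ∀ y ∈ D j \ R, x < y)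

/-- `ℱ` is a construction scheme of type `T` on `ω₁`. -/
structure IsConstructionScheme (T : SchemeType) (ℱ : Set (Finset Ordinal)) : Prop where
  nonempty_mem : ∀ F ∈ ℱ, F.Nonempty
  mem_subset : ∀ F ∈ ℱ, ↑F ⊆ Set.Iio omegaOne
  cofinal : ∀ A : Finset Ordinal, ↑A ⊆ Set.Iio omegaOne → ∃ F ∈ ℱ, A ⊆ F
  card_eq : ∀ F ∈ ℱ, ∃ k, F.card = T.m k
  inter_initSeg : ∀ k : ℕ, ∀ E ∈ ℱ, ∀ F ∈ ℱ, E.card = T.m k → F.card = T.m k →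
    InitSeg (E ∩ F) E ∧ InitSeg (E ∩ F) F
  decomp : ∀ k : ℕ, ∀ F ∈ ℱ, F.card = T.m (k + 1) → ∃ D R, IsDecomposition T ℱ k F D R

/-- `ρ(α,β)`: least `k` such that `{α,β}` is included in a member of `ℱ_k`. -/
def rho (T : SchemeType) (ℱ : Set (Finset Ordinal)) (α β : Ordinal) : ℕ :=
  sInf {k | ∃ F ∈ ℱ, F.card = T.m k ∧ α ∈ F ∧ β ∈ F}

/-- `‖α‖_k`, the cardinality of `(α)_k \ {α}`. -/
def nrm (T : SchemeType) (ℱ : Set (Finset Ordinal)) (α : Ordinal) (k : ℕ) : ℕ :=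
  Set.ncard {ξ : Ordinal | ξ < α ∧ rho T ℱ α ξ ≤ k}

/-- `Δ(α,β)`: least `k` with `‖α‖_k ≠ ‖β‖_k`. -/
def deltaOrd (T : SchemeType) (ℱ : Set (Finset Ordinal)) (α β : Ordinal) : ℕ :=
  sInf {k | nrm T ℱ α k ≠ nrm T ℱ β k}

/-- `Ξ_α(k)`. -/
def Xi (T : SchemeType) (ℱ : Set (Finset Ordinal)) (α : Ordinal) (k : ℕ) : ℤ :=
  if k = 0 then 0
  else if h : ∃ i : ℕ, ∃ F ∈ ℱ, ∃ D R, F.card = T.m k ∧ α ∈ F ∧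
      IsDecomposition T ℱ (k - 1) F D R ∧ i < T.n k ∧ α ∈ D i ∧ α ∉ R
  then (h.choose : ℤ) else -1

/-- The `a`-th element of a finite set of ordinals, in increasing order. -/
def elt (A : Finset Ordinal) (a : ℕ) : Ordinal := (A.sort (· ≤ ·)).getD a 0

/-- The family `⟨D_0, …, D_{j-1}⟩` is Δ-captured at level `l`. -/
def DeltaCapturedFam (T : SchemeType) (ℱ : Set (Finset Ordinal)) (j : ℕ)
    (D : ℕ → Finset Ordinal) (l : ℕ) : Prop :=
  ∃ R : Finset Ordinal,
    (∀ i < j, ∀ i' < j, (D i).card = (D i').card) ∧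
    (∀ i < j, ∀ i' < j, i ≠ i' → D i ∩ D i' = R) ∧
    (∀ i < j, ∀ x ∈ R, ∀ y ∈ D i \ R, x < y) ∧
    (∀ i i', i < i' → i' < j → ∀ x ∈ D i \ R, ∀ y ∈ D i' \ R, x < y) ∧
    (∀ i < j, ∀ a < R.card, Xi T ℱ (elt (D i) a) l = -1) ∧
    (∀ i < j, ∀ a, R.card ≤ a → a < (D i).card → Xi T ℱ (elt (D i) a) l = (i : ℤ)) ∧
    (∀ i < j, ∀ i' < j, i ≠ i' → ∀ a, R.card ≤ a → a < (D i).card →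
      deltaOrd T ℱ (elt (D i) a) (elt (D i') a) = l)

/-- The family `⟨D_0, …, D_{j-1}⟩` is captured at level `l`. -/
def CapturedFam (T : SchemeType) (ℱ : Set (Finset Ordinal)) (j : ℕ)
    (D : ℕ → Finset Ordinal) (l : ℕ) : Prop :=
  DeltaCapturedFam T ℱ j D l ∧
  ∀ i < j, ∀ i' < j, i ≠ i' → ∀ a, (D i ∩ D i').card ≤ a → a < (D i).card →
    rho T ℱ (elt (D i) a) (elt (D i') a) = l

/-- The ordered pair `⟨A, B⟩`, as a family. -/
def pairFam (A B : Finset Ordinal) : ℕ → Finset Ordinal := fun i => if i = 0 then A else B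

/-- A pair of ordinals `α < β` is captured at level `l`, i.e. `⟨{α},{β}⟩` is. -/
def CapturedPair (T : SchemeType) (ℱ : Set (Finset Ordinal)) (α β : Ordinal) (l : ℕ) : Prop :=
  α < β ∧ Xi T ℱ α l = 0 ∧ Xi T ℱ β l = 1 ∧ deltaOrd T ℱ α β = l ∧ rho T ℱ α β = l

/-- `ℱ` is a 2-Δ-capturing scheme. -/
def TwoDeltaCapturing (T : SchemeType) (ℱ : Set (Finset Ordinal)) : Prop :=
  ∀ 𝒮 : Set (Finset Ordinal), (∀ A ∈ 𝒮, A.Nonempty ∧ ↑A ⊆ Set.Iio omegaOne) →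
    ¬ 𝒮.Countable →
    {l : ℕ | ∃ A ∈ 𝒮, ∃ B ∈ 𝒮, A ≠ B ∧ DeltaCapturedFam T ℱ 2 (pairFam A B) l}.Infinite

/-- `ℱ` is a 2-capturing scheme. -/
def TwoCapturing (T : SchemeType) (ℱ : Set (Finset Ordinal)) : Prop :=
  ∀ 𝒮 : Set (Finset Ordinal), (∀ A ∈ 𝒮, A.Nonempty ∧ ↑A ⊆ Set.Iio omegaOne) →
    ¬ 𝒮.Countable →
    {l : ℕ | ∃ A ∈ 𝒮, ∃ B ∈ 𝒮, A ≠ B ∧ CapturedFam T ℱ 2 (pairFam A B) l}.Infinite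

/-- `ℱ` is a fully Δ-capturing scheme. -/
def FullyDeltaCapturing (T : SchemeType) (ℱ : Set (Finset Ordinal)) : Prop :=
  ∀ 𝒮 : Set (Finset Ordinal), (∀ A ∈ 𝒮, A.Nonempty ∧ ↑A ⊆ Set.Iio omegaOne) →
    ¬ 𝒮.Countable →
    {l : ℕ | ∃ D : ℕ → Finset Ordinal, (∀ i < T.n l, D i ∈ 𝒮) ∧
      (∀ i < T.n l, ∀ i' < T.n l, i ≠ i' → D i ≠ D i') ∧
      DeltaCapturedFam T ℱ (T.n l) D l}.Infinite

/-- `E` is an `n`-entangled subset of the linear order `X`. -/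
def IsNEntangled {X : Type*} [LinearOrder X] (E : Set X) (n : ℕ) : Prop :=
  ¬ E.Countable ∧
  ∀ τ : Fin n → Fin 2, ∀ 𝒜 : Set (Fin n → X),
    (∀ a ∈ 𝒜, StrictMono a ∧ ∀ i, a i ∈ E) →
    (𝒜.Pairwise fun a b => ∀ i j, a i ≠ b j) →
    ¬ 𝒜.Countable →
    ∃ a ∈ 𝒜, ∃ b ∈ 𝒜, a ≠ b ∧ ∀ i, (a i < b i ↔ τ i = 0)


/-- The sequence `e_α` (depending on a parameter `nn` and the chosen enumerations `C`). -/
def eSeq (T : SchemeType) (ℱ : Set (Finset Ordinal)) (C : ℕ → ℕ → Finset ℕ) (nn : ℕ)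
    (α : Ordinal) : ℕ → ℤ := fun k =>
  if Xi T ℱ α k ≤ 0 then 0
  else if nrm T ℱ α (k - 1) ∈ C (k - 1) (Xi T ℱ α k).toNat ∨
      ((C (k - 1) (Xi T ℱ α k).toNat).card = nn ∧
        ∀ c ∈ C (k - 1) (Xi T ℱ α k).toNat, nrm T ℱ α (k - 1) < c)
  then Xi T ℱ α k
  else -(Xi T ℱ α k)

/-- The sequence `o_α` (depending on the chosen enumerations `C`). -/
def oSeq (T : SchemeType) (ℱ : Set (Finset Ordinal)) (C : ℕ → ℕ → Finset ℕ)
    (α : Ordinal) : ℕ → ℤ := fun k =>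
  if Xi T ℱ α k ≤ 0 then 0
  else if nrm T ℱ α (k - 1) ∈ C (k - 1) (Xi T ℱ α k).toNat
  then Xi T ℱ α k
  else -(Xi T ℱ α k)

/-- `C` is an enumeration `⟨C^k_i⟩_{0<i<n_{k+1}}` (possibly with repetitions) of all subsets of
`m_k ∖ r_{k+1}` of cardinality at most `nn`. -/
def IsGoodEnum (T : SchemeType) (nn : ℕ) (C : ℕ → ℕ → Finset ℕ) : Prop :=
  (∀ k, ∀ i, 0 < i → i < T.n (k + 1) →
    C k i ⊆ Finset.Ico (T.r (k + 1)) (T.m k) ∧ (C k i).card ≤ nn) ∧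
  (∀ k, ∀ s : Finset ℕ, s ⊆ Finset.Ico (T.r (k + 1)) (T.m k) → s.card ≤ nn →
    ∃ i, 0 < i ∧ i < T.n (k + 1) ∧ C k i = s)

namespace IsConstructionScheme

variable {T : SchemeType} {ℱ : Set (Finset Ordinal)}

theorem _root_.SchemeType.strictMono_m (T : SchemeType) : StrictMono T.m := by
  refine strictMono_nat_of_lt_succ fun k => ?_
  have h1 := T.m_succ k
  have h2 := T.r_lt k
  have h3 : (T.m k - T.r (k + 1)) * 2 ≤ (T.m k - T.r (k + 1)) * T.n (k + 1) :=
    Nat.mul_le_mul_left _ (T.n_ge k)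
  omega

/-- Members of the scheme can be refined to any lower level around a given point. -/
theorem exists_subset_of_le (hS : IsConstructionScheme T ℱ) {j L : ℕ} (hjL : j ≤ L)
    {G : Finset Ordinal} (hG : G ∈ ℱ) (hc : G.card = T.m L) {x : Ordinal} (hx : x ∈ G) :
    ∃ D ∈ ℱ, D.card = T.m j ∧ x ∈ D ∧ D ⊆ G := by
  induction L, hjL using Nat.le_induction generalizing G with
  | base => exact ⟨G, hG, hc, hx, subset_rfl⟩
  | succ L _ ih =>
    obtain ⟨D, R, hD, rfl, -⟩ := hS.decomp L G hG hc
    obtain ⟨i, hi, hxi⟩ := Finset.mem_biUnion.1 hx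
    obtain ⟨E, hE, hEc, hxE, hED⟩ :=
      ih (hD i (Finset.mem_range.1 hi)).1 (hD i (Finset.mem_range.1 hi)).2 hxi
    exact ⟨E, hE, hEc, hxE, hED.trans (Finset.subset_biUnion_of_mem D hi)⟩

theorem _root_.natCast_lt_omegaOne (i : ℕ) : (i : Ordinal) < omegaOne := by
  rw [omegaOne, Cardinal.lt_ord, Ordinal.card_nat]
  exact (Cardinal.natCast_lt_aleph0).trans Cardinal.aleph0_lt_aleph_one

/-- Members of the scheme extend to any higher level. -/
theorem exists_superset_of_le (hS : IsConstructionScheme T ℱ) {j k : ℕ} (hjk : j ≤ k)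
    {E : Finset Ordinal} (hE : E ∈ ℱ) (hc : E.card = T.m j) :
    ∃ F ∈ ℱ, F.card = T.m k ∧ E ⊆ F := by
  set A : Finset Ordinal := E ∪ (Finset.range (T.m k)).image (fun i : ℕ => (i : Ordinal))
  have hA : ↑A ⊆ Set.Iio omegaOne := by
    intro x hx
    rcases Finset.mem_union.1 (Finset.mem_coe.1 hx) with h | h
    · exact hS.mem_subset E hE h
    · obtain ⟨i, -, rfl⟩ := Finset.mem_image.1 h
      exact natCast_lt_omegaOne i
  obtain ⟨G, hG, hAG⟩ := hS.cofinal A hA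
  obtain ⟨L, hL⟩ := hS.card_eq G hG
  have hkL : k ≤ L := by
    rw [← T.strictMono_m.le_iff_le, ← hL]
    calc T.m k = ((Finset.range (T.m k)).image (fun i : ℕ => (i : Ordinal))).card := by
          rw [Finset.card_image_of_injective _ Nat.cast_injective, Finset.card_range]
      _ ≤ A.card := Finset.card_le_card Finset.subset_union_right
      _ ≤ G.card := Finset.card_le_card hAG
  have hne := hS.nonempty_mem E hE
  have hmax : E.max' hne ∈ E := E.max'_mem hne
  obtain ⟨H, hH, hHc, hxH, -⟩ :=
    hS.exists_subset_of_le hkL hG hL (hAG (Finset.mem_union_left _ hmax))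
  obtain ⟨D, hD, hDc, hxD, hDH⟩ := hS.exists_subset_of_le hjk hH hHc hxH
  refine ⟨H, hH, hHc, fun y hy => hDH ?_⟩
  rcases (E.le_max' y hy).eq_or_lt with h | h
  · rwa [h]
  · exact (Finset.mem_inter.1 ((hS.inter_initSeg j E hE D hD hc hDc).1 _
      (Finset.mem_inter.2 ⟨hmax, hxD⟩) y hy h)).2

theorem exists_mem_level (hS : IsConstructionScheme T ℱ) {α : Ordinal} (hα : α < omegaOne)
    (k : ℕ) : ∃ F ∈ ℱ, F.card = T.m k ∧ α ∈ F := by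
  obtain ⟨G, hG, hαG⟩ := hS.cofinal {α} (by simpa using hα)
  obtain ⟨L, hL⟩ := hS.card_eq G hG
  have hαG' : α ∈ G := hαG (Finset.mem_singleton_self α)
  obtain ⟨D, hD, hDc, hαD, -⟩ := hS.exists_subset_of_le (Nat.zero_le L) hG hL hαG'
  obtain ⟨F, hF, hFc, hDF⟩ := hS.exists_superset_of_le (Nat.zero_le k) hD hDc
  exact ⟨F, hF, hFc, hDF hαD⟩

/-- The norm `‖α‖_k` is the position of `α` in any member of level `k` containing it. -/
theorem nrm_eq (hS : IsConstructionScheme T ℱ) {k : ℕ} {F : Finset Ordinal} (hF : F ∈ ℱ)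
    (hc : F.card = T.m k) {α : Ordinal} (hα : α ∈ F) :
    nrm T ℱ α k = (F.filter (· < α)).card := by
  rw [nrm, ← Set.ncard_coe_finset]
  congr 1
  ext ξ
  simp only [Set.mem_ofPred_eq, Finset.coe_filter]
  rw [and_comm]
  refine and_congr_left fun hξ => ⟨fun h => ?_, fun h => Nat.sInf_le ⟨F, hF, hc, hα, h⟩⟩
  have hα1 : α < omegaOne := hS.mem_subset F hF hα
  have hne : {k | ∃ F ∈ ℱ, F.card = T.m k ∧ α ∈ F ∧ ξ ∈ F}.Nonempty := by
    obtain ⟨G, hG, hsub⟩ := hS.cofinal {α, ξ} (by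
      intro x hx
      simp only [Finset.coe_insert, Finset.coe_singleton, Set.mem_insert_iff,
        Set.mem_singleton_iff] at hx
      rcases hx with rfl | rfl
      exacts [hα1, hξ.trans hα1])
    obtain ⟨L, hL⟩ := hS.card_eq G hG
    exact ⟨L, G, hG, hL, hsub (by simp), hsub (by simp)⟩
  obtain ⟨E, hE, hEc, hαE, hξE⟩ := Nat.sInf_mem hne
  obtain ⟨E', hE', hEc', hsub⟩ := hS.exists_superset_of_le h hE hEc
  exact (Finset.mem_inter.1 ((hS.inter_initSeg k E' hE' F hF hEc' hc).1 α
    (Finset.mem_inter.2 ⟨hsub hαE, hα⟩) ξ (hsub hξE) hξ)).2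

theorem nrm_lt (hS : IsConstructionScheme T ℱ) {α : Ordinal} (hα : α < omegaOne) (k : ℕ) :
    nrm T ℱ α k < T.m k := by
  obtain ⟨F, hF, hc, hαF⟩ := hS.exists_mem_level hα k
  rw [hS.nrm_eq hF hc hαF, ← hc]
  exact Finset.card_lt_card (Finset.filter_ssubset.2 ⟨α, hαF, lt_irrefl α⟩)

theorem _root_.IsDecomposition.root_subset {k : ℕ} {F : Finset Ordinal} {D : ℕ → Finset Ordinal}
    {R : Finset Ordinal} (h : IsDecomposition T ℱ k F D R) {i : ℕ} (hi : i < T.n (k + 1)) :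
    R ⊆ D i := by
  obtain ⟨-, -, -, hΔ, -, -⟩ := h
  have h2 := T.n_ge k
  rcases Nat.eq_zero_or_pos i with rfl | h0
  · rw [← hΔ 0 hi 1 (by omega) (by omega)]
    exact Finset.inter_subset_left
  · rw [← hΔ i hi 0 (by omega) (by omega)]
    exact Finset.inter_subset_left

theorem nrm_succ_of_mem_root (hS : IsConstructionScheme T ℱ) {k : ℕ} {F : Finset Ordinal}
    {D : ℕ → Finset Ordinal} {R : Finset Ordinal} (hF : F ∈ ℱ) (hc : F.card = T.m (k + 1))
    (h : IsDecomposition T ℱ k F D R) {α : Ordinal} (hα : α ∈ R) :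
    nrm T ℱ α (k + 1) = nrm T ℱ α k ∧ nrm T ℱ α k < T.r (k + 1) := by
  have hpos : 0 < T.n (k + 1) := by have := T.n_ge k; omega
  have hsub := fun {i} => h.root_subset (i := i)
  obtain ⟨hD, hU, hR, -, hlt, -⟩ := h
  have key : ∀ i < T.n (k + 1), ∀ y ∈ D i, y < α → y ∈ R := fun i hi y hy hyα => by
    by_contra hyR
    exact lt_asymm hyα (hlt i hi α hα y (Finset.mem_sdiff.2 ⟨hy, hyR⟩))
  have hFR : F.filter (· < α) = R.filter (· < α) := by
    ext y
    simp only [Finset.mem_filter, hU, Finset.mem_biUnion, Finset.mem_range]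
    refine and_congr_left fun hy => ⟨fun ⟨i, hi, hyi⟩ => key i hi y hyi hy,
      fun hyR => ⟨0, hpos, hsub hpos hyR⟩⟩
  have hDR : (D 0).filter (· < α) = R.filter (· < α) := by
    ext y
    simp only [Finset.mem_filter]
    exact and_congr_left fun hy => ⟨fun hyi => key 0 hpos y hyi hy, fun hyR => hsub hpos hyR⟩
  have hαF : α ∈ F := by
    rw [hU]; exact Finset.mem_biUnion.2 ⟨0, Finset.mem_range.2 hpos, hsub hpos hα⟩
  rw [hS.nrm_eq hF hc hαF, hS.nrm_eq (hD 0 hpos).1 (hD 0 hpos).2 (hsub hpos hα), hFR, hDR, ← hR]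
  exact ⟨rfl, Finset.card_lt_card (Finset.filter_ssubset.2 ⟨α, hα, lt_irrefl α⟩)⟩

theorem nrm_succ_of_notMem_root (hS : IsConstructionScheme T ℱ) {k : ℕ} {F : Finset Ordinal}
    {D : ℕ → Finset Ordinal} {R : Finset Ordinal} (hF : F ∈ ℱ) (hc : F.card = T.m (k + 1))
    (h : IsDecomposition T ℱ k F D R) {α : Ordinal} {i : ℕ} (hi : i < T.n (k + 1))
    (hαi : α ∈ D i) (hα : α ∉ R) :
    nrm T ℱ α (k + 1) = nrm T ℱ α k + i * (T.m k - T.r (k + 1)) ∧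
      T.r (k + 1) ≤ nrm T ℱ α k := by
  have hsub := fun {i} => h.root_subset (i := i)
  obtain ⟨hD, hU, hR, hΔ, hlt, hlt'⟩ := h
  have hαF : α ∈ F := by
    rw [hU]; exact Finset.mem_biUnion.2 ⟨i, Finset.mem_range.2 hi, hαi⟩
  have hαD : α ∈ D i \ R := Finset.mem_sdiff.2 ⟨hαi, hα⟩
  have hRi : R ⊆ (D i).filter (· < α) := fun x hx =>
    Finset.mem_filter.2 ⟨hsub hi hx, hlt i hi x hx α hαD⟩
  have hsplit : F.filter (· < α) =
      (D i).filter (· < α) ∪ (Finset.range i).biUnion fun j => D j \ R := by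
    ext y
    simp only [Finset.mem_filter, hU, Finset.mem_biUnion, Finset.mem_range, Finset.mem_union]
    constructor
    · rintro ⟨⟨j, hj, hyj⟩, hy⟩
      by_cases hyR : y ∈ R
      · exact Or.inl ⟨hsub hi hyR, hy⟩
      have hyD : y ∈ D j \ R := Finset.mem_sdiff.2 ⟨hyj, hyR⟩
      rcases lt_trichotomy j i with hji | rfl | hij
      · exact Or.inr ⟨j, hji, hyD⟩
      · exact Or.inl ⟨hyj, hy⟩
      · exact absurd hy (lt_asymm (hlt' i j hij hj α hαD y hyD))
    · rintro (⟨hy, hyα⟩ | ⟨j, hj, hy⟩)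
      · exact ⟨⟨i, hi, hy⟩, hyα⟩
      · exact ⟨⟨j, hj.trans hi, (Finset.mem_sdiff.1 hy).1⟩, hlt' j i hj hi y hy α hαD⟩
  have hcard : ∀ j < i, (D j \ R).card = T.m k - T.r (k + 1) := fun j hj => by
    rw [Finset.card_sdiff_of_subset (hsub (hj.trans hi)), (hD j (hj.trans hi)).2, hR]
  have hdisj : Disjoint ((D i).filter (· < α)) ((Finset.range i).biUnion fun j => D j \ R) := by
    rw [Finset.disjoint_left]
    intro y hy hy'
    obtain ⟨j, hj, hyj⟩ := Finset.mem_biUnion.1 hy'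
    have hj := Finset.mem_range.1 hj
    have hyj := Finset.mem_sdiff.1 hyj
    refine hyj.2 ?_
    rw [← hΔ j (hj.trans hi) i hi hj.ne]
    exact Finset.mem_inter.2 ⟨hyj.1, (Finset.mem_filter.1 hy).1⟩
  have hpd : ((Finset.range i : Finset ℕ) : Set ℕ).PairwiseDisjoint fun j => D j \ R := by
    intro j hj j' hj' hjj'
    simp only [Finset.coe_range, Set.mem_Iio] at hj hj'
    refine Finset.disjoint_left.2 fun y hy hy' => ?_
    rw [Finset.mem_sdiff] at hy hy'
    refine hy.2 ?_
    rw [← hΔ j (hj.trans hi) j' (hj'.trans hi) hjj']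
    exact Finset.mem_inter.2 ⟨hy.1, hy'.1⟩
  rw [hS.nrm_eq hF hc hαF, hS.nrm_eq (hD i hi).1 (hD i hi).2 hαi, hsplit,
    Finset.card_union_of_disjoint hdisj, Finset.card_biUnion hpd,
    Finset.sum_congr rfl fun j hj => hcard j (Finset.mem_range.1 hj), Finset.sum_const,
    Finset.card_range, smul_eq_mul, ← hR]
  exact ⟨rfl, Finset.card_le_card hRi⟩

/-- The recursion relating `‖α‖_k`, `‖α‖_{k+1}` and `Ξ_α(k+1)`. -/
theorem nrm_succ_cases (hS : IsConstructionScheme T ℱ) {α : Ordinal} (hα : α < omegaOne)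
    (k : ℕ) :
    (Xi T ℱ α (k + 1) = -1 ∧ nrm T ℱ α (k + 1) = nrm T ℱ α k ∧
      nrm T ℱ α k < T.r (k + 1)) ∨
    ∃ i < T.n (k + 1), Xi T ℱ α (k + 1) = i ∧
      nrm T ℱ α (k + 1) = nrm T ℱ α k + i * (T.m k - T.r (k + 1)) ∧
      T.r (k + 1) ≤ nrm T ℱ α k := by
  by_cases h : ∃ i : ℕ, ∃ F ∈ ℱ, ∃ D R, F.card = T.m (k + 1) ∧ α ∈ F ∧
      IsDecomposition T ℱ (k + 1 - 1) F D R ∧ i < T.n (k + 1) ∧ α ∈ D i ∧ α ∉ R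
  · right
    have hXi : Xi T ℱ α (k + 1) = (h.choose : ℤ) := by
      rw [Xi, if_neg (Nat.succ_ne_zero k), dif_pos h]
    obtain ⟨F, hF, D, R, hc, -, hdec, hi, hαi, hαR⟩ := h.choose_spec
    exact ⟨h.choose, hi, hXi, hS.nrm_succ_of_notMem_root hF hc hdec hi hαi hαR⟩
  · left
    refine ⟨by rw [Xi, if_neg (Nat.succ_ne_zero k), dif_neg h], ?_⟩
    obtain ⟨F, hF, hc, hαF⟩ := hS.exists_mem_level hα (k + 1)
    obtain ⟨D, R, hdec⟩ := hS.decomp k F hF hc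
    refine hS.nrm_succ_of_mem_root hF hc hdec ?_
    by_contra hαR
    have hαU := hαF
    rw [hdec.2.1] at hαU
    obtain ⟨i, hi, hαi⟩ := Finset.mem_biUnion.1 hαU
    exact h ⟨i, F, hF, D, R, hc, hαF, hdec, Finset.mem_range.1 hi, hαi, hαR⟩

/-- Norms at level `k + 1` determine norms at level `k`. -/
theorem nrm_eq_of_nrm_succ_eq (hS : IsConstructionScheme T ℱ) {α β : Ordinal}
    (hα : α < omegaOne) (hβ : β < omegaOne) {k : ℕ}
    (h : nrm T ℱ α (k + 1) = nrm T ℱ β (k + 1)) : nrm T ℱ α k = nrm T ℱ β k := by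
  have hr := T.r_lt k
  have hpα := hS.nrm_lt hα k
  have hpβ := hS.nrm_lt hβ k
  rcases hS.nrm_succ_cases hα k with ⟨-, h1, h2⟩ | ⟨i, -, -, h1, h2⟩ <;>
    rcases hS.nrm_succ_cases hβ k with ⟨-, h3, h4⟩ | ⟨j, -, -, h3, h4⟩
  · omega
  · omega
  · omega
  · rcases lt_trichotomy i j with hij | rfl | hij
    · have := Nat.mul_le_mul_right (T.m k - T.r (k + 1)) (Nat.succ_le_of_lt hij)
      rw [Nat.succ_mul] at this
      omega
    · omega
    · have := Nat.mul_le_mul_right (T.m k - T.r (k + 1)) (Nat.succ_le_of_lt hij)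
      rw [Nat.succ_mul] at this
      omega

theorem nrm_eq_of_le (hS : IsConstructionScheme T ℱ) {α β : Ordinal}
    (hα : α < omegaOne) (hβ : β < omegaOne) {j k : ℕ} (hjk : j ≤ k)
    (h : nrm T ℱ α k = nrm T ℱ β k) : nrm T ℱ α j = nrm T ℱ β j := by
  induction k, hjk using Nat.le_induction with
  | base => exact h
  | succ k _ ih => exact ih (hS.nrm_eq_of_nrm_succ_eq hα hβ h)

theorem Xi_eq_of_nrm_eq (hS : IsConstructionScheme T ℱ) {α β : Ordinal}
    (hα : α < omegaOne) (hβ : β < omegaOne) {k : ℕ}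
    (h : nrm T ℱ α k = nrm T ℱ β k) : Xi T ℱ α k = Xi T ℱ β k := by
  cases k with
  | zero => simp [Xi]
  | succ k =>
    have h' := hS.nrm_eq_of_nrm_succ_eq hα hβ h
    have hr : 0 < T.m k - T.r (k + 1) := Nat.sub_pos_of_lt (T.r_lt k)
    rcases hS.nrm_succ_cases hα k with ⟨h0, h1, h2⟩ | ⟨i, -, h0, h1, h2⟩ <;>
      rcases hS.nrm_succ_cases hβ k with ⟨h0', h3, h4⟩ | ⟨j, -, h0', h3, h4⟩
    · rw [h0, h0']
    · omega
    · omega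
    · have : i = j := Nat.eq_of_mul_eq_mul_right hr (by omega)
      rw [h0, h0', this]

theorem oSeq_eq_of_nrm_eq (hS : IsConstructionScheme T ℱ) (C : ℕ → ℕ → Finset ℕ)
    {α β : Ordinal} (hα : α < omegaOne) (hβ : β < omegaOne) {j k : ℕ} (hjk : j ≤ k)
    (h : nrm T ℱ α k = nrm T ℱ β k) : oSeq T ℱ C α j = oSeq T ℱ C β j := by
  simp only [oSeq, hS.Xi_eq_of_nrm_eq hα hβ (hS.nrm_eq_of_le hα hβ hjk h),
    hS.nrm_eq_of_le hα hβ ((Nat.sub_le j 1).trans hjk) h]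

theorem exists_nrm_ne (hS : IsConstructionScheme T ℱ) {α β : Ordinal}
    (hα : α < omegaOne) (hβ : β < omegaOne) (hne : α ≠ β) :
    ∃ k, nrm T ℱ α k ≠ nrm T ℱ β k := by
  wlog hlt : α < β generalizing α β
  · obtain ⟨k, hk⟩ := this hβ hα hne.symm (lt_of_le_of_ne (not_lt.1 hlt) hne.symm)
    exact ⟨k, hk.symm⟩
  obtain ⟨F, hF, hsub⟩ := hS.cofinal {α, β} (by
    intro x hx
    simp only [Finset.coe_insert, Finset.coe_singleton, Set.mem_insert_iff,
      Set.mem_singleton_iff] at hx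
    rcases hx with rfl | rfl
    exacts [hα, hβ])
  obtain ⟨k, hc⟩ := hS.card_eq F hF
  have hαF : α ∈ F := hsub (by simp)
  refine ⟨k, ?_⟩
  rw [hS.nrm_eq hF hc hαF, hS.nrm_eq hF hc (hsub (by simp) : β ∈ F)]
  refine (Finset.card_lt_card ⟨fun x hx => ?_, fun h => ?_⟩).ne
  · rw [Finset.mem_filter] at hx ⊢
    exact ⟨hx.1, hx.2.trans hlt⟩
  · exact lt_irrefl α (Finset.mem_filter.1 (h (Finset.mem_filter.2 ⟨hαF, hlt⟩))).2

/-- The first level at which the norms of two ordinals split is a successor. -/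
theorem exists_nrm_split (hS : IsConstructionScheme T ℱ) {α β : Ordinal}
    (hα : α < omegaOne) (hβ : β < omegaOne) (hne : α ≠ β) :
    ∃ k, nrm T ℱ α k = nrm T ℱ β k ∧ nrm T ℱ α (k + 1) ≠ nrm T ℱ β (k + 1) := by
  by_contra! hcon
  obtain ⟨k, hk⟩ := hS.exists_nrm_ne hα hβ hne
  refine hk ?_
  clear hk
  induction k with
  | zero =>
    have h1 := hS.nrm_lt hα 0
    have h2 := hS.nrm_lt hβ 0
    rw [T.m_zero] at h1 h2
    omega
  | succ k ih => exact hcon k ih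

theorem _root_.toLex_lt_toLex_iff_of_first_ne {f g : ℕ → ℤ} {l : ℕ} (h : ∀ j < l, f j = g j)
    (hl : f l ≠ g l) : toLex f < toLex g ↔ f l < g l := by
  constructor
  · rintro ⟨d, hd, hlt⟩
    simp only [Pi.toLex_apply] at hd hlt
    rcases lt_trichotomy d l with hdl | rfl | hld
    · exact absurd hlt (by simp [h d hdl])
    · exact hlt
    · exact absurd (hd l hld) hl
  · exact fun hlt => ⟨l, h, hlt⟩

/-- The lexicographic comparison of `o_α` and `o_β` is decided at the level `k + 1` where the
norms of `α` and `β` split. -/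
theorem toLex_oSeq_lt_iff (hS : IsConstructionScheme T ℱ) (C : ℕ → ℕ → Finset ℕ)
    {α β : Ordinal} (hα : α < omegaOne) (hβ : β < omegaOne) {k : ℕ}
    (h : nrm T ℱ α k = nrm T ℱ β k) (h' : nrm T ℱ α (k + 1) ≠ nrm T ℱ β (k + 1)) :
    ∃ x < T.n (k + 1), ∃ y < T.n (k + 1), x ≠ y ∧
      nrm T ℱ α (k + 1) = nrm T ℱ α k + x * (T.m k - T.r (k + 1)) ∧
      nrm T ℱ β (k + 1) = nrm T ℱ β k + y * (T.m k - T.r (k + 1)) ∧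
      toLex (oSeq T ℱ C α) ≠ toLex (oSeq T ℱ C β) ∧
      (x < y → (toLex (oSeq T ℱ C α) < toLex (oSeq T ℱ C β) ↔ nrm T ℱ α k ∈ C k y)) ∧
      (y < x → (toLex (oSeq T ℱ C α) < toLex (oSeq T ℱ C β) ↔ nrm T ℱ α k ∉ C k x)) := by
  rcases hS.nrm_succ_cases hα k with ⟨h0, h1, h2⟩ | ⟨x, hx, h0, h1, h2⟩ <;>
    rcases hS.nrm_succ_cases hβ k with ⟨h0', h3, h4⟩ | ⟨y, hy, h0', h3, h4⟩
  · omega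
  · omega
  · omega
  have hxy : x ≠ y := by rintro rfl; omega
  have hoα : oSeq T ℱ C α (k + 1) = if nrm T ℱ α k ∈ C k x then (x : ℤ) else -x := by
    rw [oSeq, h0]
    rcases Nat.eq_zero_or_pos x with rfl | hx0
    · simp
    · rw [if_neg (by omega)]; simp
  have hoβ : oSeq T ℱ C β (k + 1) = if nrm T ℱ α k ∈ C k y then (y : ℤ) else -y := by
    rw [oSeq, h0', h]
    rcases Nat.eq_zero_or_pos y with rfl | hy0
    · simp
    · rw [if_neg (by omega)]; simp
  have hne : oSeq T ℱ C α (k + 1) ≠ oSeq T ℱ C β (k + 1) := by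
    rw [hoα, hoβ]; split_ifs <;> omega
  have hiff := toLex_lt_toLex_iff_of_first_ne (l := k + 1)
    (fun j hj => hS.oSeq_eq_of_nrm_eq C hα hβ (Nat.le_of_lt_succ hj) h) hne
  refine ⟨x, hx, y, hy, hxy, h1, h3, fun he => hne (congrFun (toLex.injective he) _), ?_, ?_⟩
  · intro hlt
    rw [hiff, hoα, hoβ]
    split_ifs <;> simp_all <;> omega
  · intro hlt
    rw [hiff, hoα, hoβ]
    split_ifs <;> simp_all <;> omega

theorem toLex_oSeq_ne (hS : IsConstructionScheme T ℱ) (C : ℕ → ℕ → Finset ℕ)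
    {α β : Ordinal} (hα : α < omegaOne) (hβ : β < omegaOne) (hne : α ≠ β) :
    toLex (oSeq T ℱ C α) ≠ toLex (oSeq T ℱ C β) := by
  obtain ⟨k, h, h'⟩ := hS.exists_nrm_split hα hβ hne
  obtain ⟨x, -, y, -, -, -, -, h, -⟩ := hS.toLex_oSeq_lt_iff C hα hβ h h'
  exact h

theorem nrm_add_natCast (hS : IsConstructionScheme T ℱ) {N k : ℕ} {α : Ordinal}
    {F : Finset Ordinal} (hF : F ∈ ℱ) (hc : F.card = T.m k)
    (hsub : ∀ i < N, α + (i : Ordinal) ∈ F) {l : ℕ} (hkl : k ≤ l) {i : ℕ} (hi : i < N) :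
    nrm T ℱ (α + i) l = nrm T ℱ α l + i := by
  obtain ⟨G, hG, hGc, hFG⟩ := hS.exists_superset_of_le hkl hF hc
  induction i with
  | zero => simp
  | succ i ih =>
    specialize ih (by omega)
    have hαi : α + (i : Ordinal) ∈ G := hFG (hsub i (by omega))
    rw [hS.nrm_eq hG hGc hαi] at ih
    have : G.filter (· < α + ((i + 1 : ℕ) : Ordinal)) =
        insert (α + (i : Ordinal)) (G.filter (· < α + (i : Ordinal))) := by
      ext y
      have hs : α + ((i + 1 : ℕ) : Ordinal) = Order.succ (α + (i : Ordinal)) := by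
        rw [Nat.cast_add, Nat.cast_one, ← add_assoc, Order.succ_eq_add_one]
      simp only [Finset.mem_filter, Finset.mem_insert, hs, Order.lt_succ_iff]
      constructor
      · rintro ⟨h1, h2⟩
        exact h2.eq_or_lt.imp id fun h => ⟨h1, h⟩
      · rintro (rfl | ⟨h1, h2⟩)
        exacts [⟨hαi, le_rfl⟩, ⟨h1, h2.le⟩]
    rw [hS.nrm_eq hG hGc (hFG (hsub (i + 1) hi)), this,
      Finset.card_insert_of_notMem (by simp), ih, add_assoc]

/-- For two blocks of consecutive ordinals with the same position at level `k`, the comparisons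
between corresponding elements are given by membership in, or in the complement of, a single set
with at most `nn` elements. -/
theorem exists_card_le_forall_toLex_oSeq_lt_iff (hS : IsConstructionScheme T ℱ)
    {C : ℕ → ℕ → Finset ℕ} {nn : ℕ} (hC : IsGoodEnum T nn C) {N k : ℕ} (hN : 0 < N)
    {α β : Ordinal} (hne : α ≠ β)
    (hα : ∃ F ∈ ℱ, F.card = T.m k ∧ ∀ i < N, α + (i : Ordinal) ∈ F)
    (hβ : ∃ F ∈ ℱ, F.card = T.m k ∧ ∀ i < N, β + (i : Ordinal) ∈ F)
    (h : nrm T ℱ α k = nrm T ℱ β k) :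
    ∃ S : Finset (Fin N), S.card ≤ nn ∧
      ((∀ i : Fin N, toLex (oSeq T ℱ C (α + (i : ℕ))) < toLex (oSeq T ℱ C (β + (i : ℕ))) ↔
          i ∈ S) ∨
        ∀ i : Fin N, toLex (oSeq T ℱ C (α + (i : ℕ))) < toLex (oSeq T ℱ C (β + (i : ℕ))) ↔
          i ∉ S) := by
  obtain ⟨F, hF, hFc, hαF⟩ := hα
  obtain ⟨G, hG, hGc, hβG⟩ := hβ
  have hα1 : ∀ i < N, α + (i : Ordinal) < omegaOne := fun i hi => hS.mem_subset F hF (hαF i hi)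
  have hβ1 : ∀ i < N, β + (i : Ordinal) < omegaOne := fun i hi => hS.mem_subset G hG (hβG i hi)
  have hα0 : α < omegaOne := by simpa using hα1 0 hN
  have hβ0 : β < omegaOne := by simpa using hβ1 0 hN
  obtain ⟨l, hl, hl'⟩ := hS.exists_nrm_split hα0 hβ0 hne
  have hkl : k ≤ l := by
    by_contra! hlk
    exact hl' (hS.nrm_eq_of_le hα0 hβ0 hlk h)
  have hr : 0 < T.m l - T.r (l + 1) := Nat.sub_pos_of_lt (T.r_lt l)
  have eα : ∀ {j} (_ : k ≤ j) {i} (_ : i < N), nrm T ℱ (α + (i : ℕ)) j = nrm T ℱ α j + i :=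
    fun hj _ hi => hS.nrm_add_natCast hF hFc hαF hj hi
  have eβ : ∀ {j} (_ : k ≤ j) {i} (_ : i < N), nrm T ℱ (β + (i : ℕ)) j = nrm T ℱ β j + i :=
    fun hj _ hi => hS.nrm_add_natCast hG hGc hβG hj hi
  obtain ⟨x, hx, y, hy, hxy, h1, h2, -⟩ := hS.toLex_oSeq_lt_iff C hα0 hβ0 hl hl'
  have key : ∀ i : Fin N,
      (x < y → (toLex (oSeq T ℱ C (α + (i : ℕ))) < toLex (oSeq T ℱ C (β + (i : ℕ))) ↔
        nrm T ℱ α l + i ∈ C l y)) ∧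
      (y < x → (toLex (oSeq T ℱ C (α + (i : ℕ))) < toLex (oSeq T ℱ C (β + (i : ℕ))) ↔
        nrm T ℱ α l + i ∉ C l x)) := fun i => by
    have e1 := eα hkl i.2
    have e2 := eβ hkl i.2
    have e3 := eα (j := l + 1) (by omega) i.2
    have e4 := eβ (j := l + 1) (by omega) i.2
    obtain ⟨x', -, y', -, -, h3, h4, -, h5⟩ :=
      hS.toLex_oSeq_lt_iff C (hα1 i i.2) (hβ1 i i.2) (k := l) (by omega) (by omega)
    have hx' : x' = x := Nat.eq_of_mul_eq_mul_right hr (by omega)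
    have hy' : y' = y := Nat.eq_of_mul_eq_mul_right hr (by omega)
    rwa [hx', hy', e1] at h5
  have hcard : ∀ s : Finset ℕ, s.card ≤ nn →
      (Finset.univ.filter fun i : Fin N => nrm T ℱ α l + i ∈ s).card ≤ nn := fun s hs => by
    refine (Finset.card_le_card_of_injOn (fun i : Fin N => nrm T ℱ α l + i) ?_ ?_).trans hs
    · intro i hi
      simpa using hi
    · intro i _ j _ hij
      exact Fin.ext (Nat.add_left_cancel hij)
  rcases lt_or_gt_of_ne hxy with hlt | hlt
  · refine ⟨_, hcard (C l y) (hC.1 l y (by omega) hy).2, Or.inl fun i => ?_⟩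
    simpa using (key i).1 hlt
  · refine ⟨_, hcard (C l x) (hC.1 l x (by omega) hx).2, Or.inr fun i => ?_⟩
    simpa using (key i).2 hlt

end IsConstructionScheme

theorem omega0_mul_add_natCast_lt_omegaOne {ξ : Ordinal} (hξ : ξ < omegaOne) (i : ℕ) :
    Ordinal.omega0 * ξ + i < omegaOne := by
  rw [omegaOne, Cardinal.lt_ord] at *
  rw [Ordinal.card_add, Ordinal.card_mul, Ordinal.card_omega0, Ordinal.card_nat]
  have h1 := Cardinal.aleph0_le_aleph 1
  exact Cardinal.add_lt_of_lt h1
    (Cardinal.mul_lt_of_lt h1 Cardinal.aleph0_lt_aleph_one hξ)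
    (Cardinal.natCast_lt_aleph0.trans Cardinal.aleph0_lt_aleph_one)

theorem omega0_mul_add_natCast_inj {ξ η : Ordinal} {i j : ℕ}
    (h : Ordinal.omega0 * ξ + i = Ordinal.omega0 * η + j) : ξ = η := by
  have key : ∀ (ζ : Ordinal) (n : ℕ), (Ordinal.omega0 * ζ + n) / Ordinal.omega0 = ζ := fun ζ n => by
    rw [Ordinal.mul_add_div _ Ordinal.omega0_ne_zero, Ordinal.div_eq_zero_of_lt
      (Ordinal.natCast_lt_omega0 n), add_zero]
  rw [← key ξ i, h, key]

theorem not_countable_Iio_omegaOne : ¬ (Set.Iio omegaOne).Countable := by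
  rw [← Cardinal.le_aleph0_iff_set_countable, Cardinal.mk_Iio_ordinal, omegaOne,
    Cardinal.card_ord, not_le]
  simp

/-- A map from an uncountable set to a countable type has an uncountable fibre. -/
theorem Set.exists_not_countable_fiber {ι κ : Type*} [Countable κ] {s : Set ι}
    (hs : ¬ s.Countable) (f : ι → κ) : ∃ c, ¬ {x ∈ s | f x = c}.Countable := by
  by_contra! h
  refine hs ((Set.countable_iUnion h).mono fun x hx => ?_)
  exact Set.mem_iUnion.2 ⟨f x, hx, rfl⟩

theorem not_alternating_of_card_le {nn : ℕ} {S : Finset (Fin (2 * nn + 2))} (hS : S.card ≤ nn)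
    (σ : Equiv.Perm (Fin (2 * nn + 2))) :
    ¬ (∀ i : Fin (2 * nn + 2), Even (i : ℕ) → σ i ∈ S) ∧
      ¬ (∀ i : Fin (2 * nn + 2), ¬ Even (i : ℕ) → σ i ∈ S) := by
  have key : ∀ f : Fin (nn + 1) → Fin (2 * nn + 2), Function.Injective f →
      ¬ ∀ j, σ (f j) ∈ S := fun f hf h => by
    have := Finset.card_le_card_of_injOn (s := Finset.univ) (t := S) (fun j => σ (f j))
      (fun j _ => h j) ((σ.injective.comp hf).injOn)
    rw [Finset.card_univ, Fintype.card_fin] at this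
    omega
  constructor
  · refine fun h => key (fun j => ⟨2 * j, by omega⟩) (fun a b hab => ?_) fun j => h _ (by simp)
    simp only [Fin.mk.injEq] at hab
    omega
  · refine fun h => key (fun j => ⟨2 * j + 1, by omega⟩) (fun a b hab => ?_) fun j => h _ (by simp)
    simp only [Fin.mk.injEq] at hab
    omega

theorem exists_uncountable_not_alternating {T : SchemeType} {ℱ : Set (Finset Ordinal)}
    (hS : IsConstructionScheme T ℱ) {nn : ℕ} {C : ℕ → ℕ → Finset ℕ} (hC : IsGoodEnum T nn C) :
    ∃ 𝒜 : Set (Fin (2 * nn + 2) → Lex (ℕ → ℤ)),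
      (∀ a ∈ 𝒜, StrictMono a ∧
        ∀ i, a i ∈ (fun α => toLex (oSeq T ℱ C α)) '' Set.Iio omegaOne) ∧
      (𝒜.Pairwise fun a b => ∀ i j, a i ≠ b j) ∧
      ¬ 𝒜.Countable ∧
      ∀ a ∈ 𝒜, ∀ b ∈ 𝒜, a ≠ b →
        ¬ (∀ i : Fin (2 * nn + 2), a i < b i ↔ Even (i : ℕ)) ∧
        ¬ (∀ i : Fin (2 * nn + 2), a i < b i ↔ ¬ Even (i : ℕ)) := by
  set N := 2 * nn + 2 with hN
  let g : Ordinal → Fin N → Lex (ℕ → ℤ) :=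
    fun ξ i => toLex (oSeq T ℱ C (Ordinal.omega0 * ξ + (i : ℕ)))
  have hlevel : ∀ ξ : Ordinal, ∃ k, ξ < omegaOne →
      ∃ F ∈ ℱ, F.card = T.m k ∧ ∀ i < N, Ordinal.omega0 * ξ + (i : ℕ) ∈ F := fun ξ => by
    by_cases hξ : ξ < omegaOne
    · obtain ⟨F, hF, hsub⟩ := hS.cofinal
        ((Finset.range N).image fun i : ℕ => Ordinal.omega0 * ξ + (i : Ordinal)) (by
          intro x hx
          obtain ⟨i, -, rfl⟩ := Finset.mem_image.1 (Finset.mem_coe.1 hx)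
          exact omega0_mul_add_natCast_lt_omegaOne hξ i)
      obtain ⟨k, hk⟩ := hS.card_eq F hF
      exact ⟨k, fun _ => ⟨F, hF, hk, fun i hi =>
        hsub (Finset.mem_image_of_mem _ (Finset.mem_range.2 hi))⟩⟩
    · exact ⟨0, fun h => absurd h hξ⟩
  choose K hK using hlevel
  obtain ⟨⟨k, p, σ⟩, hU⟩ := Set.exists_not_countable_fiber not_countable_Iio_omegaOne
    fun ξ => (K ξ, nrm T ℱ (Ordinal.omega0 * ξ) (K ξ), Tuple.sort (g ξ))
  set U := {ξ ∈ Set.Iio omegaOne |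
    (K ξ, nrm T ℱ (Ordinal.omega0 * ξ) (K ξ), Tuple.sort (g ξ)) = (k, p, σ)}
  have hUlt : ∀ ξ ∈ U, ξ < omegaOne := fun ξ h => h.1
  have hUK : ∀ ξ ∈ U, K ξ = k := fun ξ h => (Prod.mk.inj h.2).1
  have hUp : ∀ ξ ∈ U, nrm T ℱ (Ordinal.omega0 * ξ) k = p := fun ξ h => by
    rw [← hUK ξ h]; exact (Prod.mk.inj (Prod.mk.inj h.2).2).1
  have hUσ : ∀ ξ ∈ U, Tuple.sort (g ξ) = σ := fun ξ h => (Prod.mk.inj (Prod.mk.inj h.2).2).2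
  have hgne : ∀ ξ ∈ U, ∀ η ∈ U, ξ ≠ η → ∀ i j, g ξ i ≠ g η j := fun ξ hξ η hη hne i j =>
    hS.toLex_oSeq_ne C (omega0_mul_add_natCast_lt_omegaOne (hUlt ξ hξ) i)
      (omega0_mul_add_natCast_lt_omegaOne (hUlt η hη) j)
      fun h => hne (omega0_mul_add_natCast_inj h)
  have hginj : ∀ ξ ∈ U, Function.Injective (g ξ) := fun ξ hξ i j hij => by
    by_contra hne
    refine hS.toLex_oSeq_ne C (omega0_mul_add_natCast_lt_omegaOne (hUlt ξ hξ) i)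
      (omega0_mul_add_natCast_lt_omegaOne (hUlt ξ hξ) j) (fun h => hne ?_) hij
    exact Fin.ext (Nat.cast_injective (add_left_cancel h))
  refine ⟨(fun ξ => g ξ ∘ σ) '' U, ?_, ?_, ?_, ?_⟩
  · rintro _ ⟨ξ, hξ, rfl⟩
    refine ⟨?_, fun i => ⟨_, omega0_mul_add_natCast_lt_omegaOne (hUlt ξ hξ) (σ i), rfl⟩⟩
    refine Monotone.strictMono_of_injective ?_ ((hginj ξ hξ).comp σ.injective)
    have := Tuple.monotone_sort (g ξ)
    rwa [hUσ ξ hξ] at this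
  · rintro _ ⟨ξ, hξ, rfl⟩ _ ⟨η, hη, rfl⟩ hne i j
    exact hgne ξ hξ η hη (fun h => hne (by rw [h])) _ _
  · intro hcount
    refine hU (Set.countable_of_injective_of_countable_image (fun ξ hξ η hη h => ?_) hcount)
    by_contra hne
    exact hgne ξ hξ η hη hne _ _ (congrFun h ⟨0, by omega⟩)
  · rintro _ ⟨ξ, hξ, rfl⟩ _ ⟨η, hη, rfl⟩ hne
    have hξη : ξ ≠ η := fun h => hne (by rw [h])
    obtain ⟨S, hScard, hcmp⟩ := hS.exists_card_le_forall_toLex_oSeq_lt_iff hC (N := N) (k := k)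
      (α := Ordinal.omega0 * ξ) (β := Ordinal.omega0 * η) (by omega)
      (fun h => hξη (omega0_mul_add_natCast_inj (i := 0) (j := 0) (by rw [h])))
      (hUK ξ hξ ▸ hK ξ (hUlt ξ hξ)) (hUK η hη ▸ hK η (hUlt η hη))
      ((hUp ξ hξ).trans (hUp η hη).symm)
    obtain ⟨heven, hodd⟩ := not_alternating_of_card_le hScard σ
    rcases hcmp with hcmp | hcmp
    · exact ⟨fun h => heven fun i hi => (hcmp (σ i)).1 ((h i).2 hi),
        fun h => hodd fun i hi => (hcmp (σ i)).1 ((h i).2 hi)⟩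
    · refine ⟨fun h => hodd fun i hi => ?_, fun h => heven fun i hi => ?_⟩
      · by_contra hm
        exact hi ((h i).1 ((hcmp (σ i)).2 hm))
      · by_contra hm
        exact (h i).1 ((hcmp (σ i)).2 hm) hi


/-- Under the same hypotheses, `𝔼_o` is not `(2n+2)`-entangled: there is an uncountable family
of pairwise disjoint `(2n+2)`-element subsets of `𝔼_o` no two distinct members of which realize
the alternating type (`0` at even coordinates, `1` at odd ones) nor its flip. -/
theorem stmt6 (T : SchemeType) (ℱ : Set (Finset Ordinal))
    (hS : IsConstructionScheme T ℱ) (hcap : FullyDeltaCapturing T ℱ)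
    (hgrow : ∀ k, 2 ^ T.m k ≤ T.n (k + 1))
    (nn : ℕ) (hn : 1 ≤ nn) (C : ℕ → ℕ → Finset ℕ) (hC : IsGoodEnum T nn C) :
    ¬ IsNEntangled ((fun α => toLex (oSeq T ℱ C α)) '' Set.Iio omegaOne) (2 * nn + 2) ∧
    ∃ 𝒜 : Set (Fin (2 * nn + 2) → Lex (ℕ → ℤ)),
      (∀ a ∈ 𝒜, StrictMono a ∧
        ∀ i, a i ∈ (fun α => toLex (oSeq T ℱ C α)) '' Set.Iio omegaOne) ∧
      (𝒜.Pairwise fun a b => ∀ i j, a i ≠ b j) ∧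
      ¬ 𝒜.Countable ∧
      ∀ a ∈ 𝒜, ∀ b ∈ 𝒜, a ≠ b →
        ¬ (∀ i : Fin (2 * nn + 2), a i < b i ↔ Even (i : ℕ)) ∧
        ¬ (∀ i : Fin (2 * nn + 2), a i < b i ↔ ¬ Even (i : ℕ)) := by
  obtain ⟨𝒜, h1, h2, h3, h4⟩ := exists_uncountable_not_alternating hS hC
  refine ⟨fun hE => ?_, 𝒜, h1, h2, h3, h4⟩
  obtain ⟨a, ha, b, hb, hne, hab⟩ :=
    hE.2 (fun i => if Even (i : ℕ) then 0 else 1) 𝒜 h1 h2 h3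
  refine (h4 a ha b hb hne).1 fun i => (hab i).trans ?_
  by_cases hi : Even (i : ℕ) <;> simp [hi]

end
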